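/- Let a1, ..., a6 ∈ ℝ and set a7 = a4 + a5 − a6, a8 = a1 + a2 + a3 − a4 − a5. The 9×9 complex matrix L₃ = a1·λ1⊗λ1 + a2·λ2ᵀ⊗λ2 + a3·λ3⊗λ3 + a4·λ4⊗λ4 + a5·λ5ᵀ⊗λ5 + a6·λ6⊗λ6 + a7·λ7ᵀ⊗λ7 + a8·λ8⊗λ8 − (2/3)(2a1+2a2+2a3+a4+a5)·I₉ has characteristic polynomial ∏ᵢ₌₁⁹ (X − αᵢ), where α1 = 0, α2 = −2a1−2a2−a4−a5, α3 = −2a1−2a3−a4−a5, α4 = −2a2−2a3−a4−a5, α5 = −2a1−2a2−2a3+a4−a5, α6 = −2a1−2a2−2a3−a4+a5, α7 = −3(a4+a5), α8 = −2a1−2a2−2a3+a4+a5−2a6, α9 = −2a1−2a2−2a3−a4−a5+2a6. -/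

import Mathlib

open Matrix Complex Kronecker Polynomial

noncomputable section

/-- The Gell-Mann matrices. -/
def gm1 : Matrix (Fin 3) (Fin 3) ℂ := !![0, 1, 0; 1, 0, 0; 0, 0, 0]
def gm2 : Matrix (Fin 3) (Fin 3) ℂ := !![0, -I, 0; I, 0, 0; 0, 0, 0]
def gm3 : Matrix (Fin 3) (Fin 3) ℂ := !![1, 0, 0; 0, -1, 0; 0, 0, 0]
def gm4 : Matrix (Fin 3) (Fin 3) ℂ := !![0, 0, 1; 0, 0, 0; 1, 0, 0]
def gm5 : Matrix (Fin 3) (Fin 3) ℂ := !![0, 0, -I; 0, 0, 0; I, 0, 0]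
def gm6 : Matrix (Fin 3) (Fin 3) ℂ := !![0, 0, 0; 0, 0, 1; 0, 1, 0]
def gm7 : Matrix (Fin 3) (Fin 3) ℂ := !![0, 0, 0; 0, 0, -I; 0, I, 0]
def gm8 : Matrix (Fin 3) (Fin 3) ℂ :=
  ((↑(Real.sqrt 3) : ℂ))⁻¹ • !![1, 0, 0; 0, 1, 0; 0, 0, -2]

/-- The generator of evolution for 3-level systems, with `a7 = a4+a5−a6` and
`a8 = a1+a2+a3−a4−a5` substituted. -/
def gen3 (a1 a2 a3 a4 a5 a6 : ℝ) : Matrix (Fin 3 × Fin 3) (Fin 3 × Fin 3) ℂ :=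
  (a1 : ℂ) • (gm1 ⊗ₖ gm1) + (a2 : ℂ) • (gm2ᵀ ⊗ₖ gm2) + (a3 : ℂ) • (gm3 ⊗ₖ gm3)
    + (a4 : ℂ) • (gm4 ⊗ₖ gm4) + (a5 : ℂ) • (gm5ᵀ ⊗ₖ gm5) + (a6 : ℂ) • (gm6 ⊗ₖ gm6)
    + ((a4 + a5 - a6 : ℝ) : ℂ) • (gm7ᵀ ⊗ₖ gm7)
    + ((a1 + a2 + a3 - a4 - a5 : ℝ) : ℂ) • (gm8 ⊗ₖ gm8)
    - ((2 / 3 * (2 * a1 + 2 * a2 + 2 * a3 + a4 + a5) : ℝ) : ℂ)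
        • (1 : Matrix (Fin 3 × Fin 3) (Fin 3 × Fin 3) ℂ)

/-- The nine basis vectors, grouped by invariant subspace. -/
def grp : Fin 3 × Fin 3 → Fin 3 ⊕ (Fin 2 ⊕ (Fin 2 ⊕ Fin 2)) := fun p =>
  (!![Sum.inl 0, Sum.inr (Sum.inl 0), Sum.inr (Sum.inr (Sum.inl 0));
    Sum.inr (Sum.inl 1), Sum.inl 1, Sum.inr (Sum.inr (Sum.inr 0));
    Sum.inr (Sum.inr (Sum.inl 1)), Sum.inr (Sum.inr (Sum.inr 1)), Sum.inl 2] :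
    Matrix (Fin 3) (Fin 3) (Fin 3 ⊕ (Fin 2 ⊕ (Fin 2 ⊕ Fin 2)))) p.1 p.2

/-- The inverse of `grp`. -/
def ungrp : Fin 3 ⊕ (Fin 2 ⊕ (Fin 2 ⊕ Fin 2)) → Fin 3 × Fin 3 :=
  Sum.elim ![(0, 0), (1, 1), (2, 2)] (Sum.elim ![(0, 1), (1, 0)]
    (Sum.elim ![(0, 2), (2, 0)] ![(1, 2), (2, 1)]))

/-- `grp` as an equivalence. -/
def grpEquiv : Fin 3 × Fin 3 ≃ Fin 3 ⊕ (Fin 2 ⊕ (Fin 2 ⊕ Fin 2)) where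
  toFun := grp
  invFun := ungrp
  left_inv := by decide
  right_inv := by decide

lemma two_charpoly (d b : ℂ) :
    (!![d, b; b, d] : Matrix (Fin 2) (Fin 2) ℂ).charpoly
      = (X - C (d + b)) * (X - C (d - b)) := by
  simp only [Matrix.charpoly_fin_two, Matrix.trace_fin_two_of, Matrix.det_fin_two_of, C_add, C_sub,
    C_mul]
  ring

lemma three_charpoly (p u : ℂ) :
    (!![-p - u, p, u; p, -p - u, u; u, u, -2 * u] : Matrix (Fin 3) (Fin 3) ℂ).charpoly
      = X * (X - C (-2 * p - u)) * (X - C (-3 * u)) := by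
  have h2 : (C 2 : ℂ[X]) = 2 := rfl
  have h3 : (C 3 : ℂ[X]) = 3 := rfl
  simp [Matrix.charpoly, Matrix.det_fin_three, h2, h3]
  ring

lemma sqrt_three_inv : ((↑(Real.sqrt 3) : ℂ))⁻¹ * ((↑(Real.sqrt 3) : ℂ))⁻¹ = 1 / 3 := by
  rw [← mul_inv, ← Complex.ofReal_mul, Real.mul_self_sqrt (by norm_num)]
  norm_num

lemma gm8_kron : gm8 ⊗ₖ gm8 = (1 / 3 : ℂ) •
    ((!![1, 0, 0; 0, 1, 0; 0, 0, -2] : Matrix (Fin 3) (Fin 3) ℂ) ⊗ₖ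
      (!![1, 0, 0; 0, 1, 0; 0, 0, -2] : Matrix (Fin 3) (Fin 3) ℂ)) := by
  rw [gm8, Matrix.smul_kronecker, Matrix.kronecker_smul, smul_smul, sqrt_three_inv]

set_option maxHeartbeats 4000000 in
lemma gen3_blocks (a1 a2 a3 a4 a5 a6 : ℝ) :
    Matrix.reindex grpEquiv grpEquiv (gen3 a1 a2 a3 a4 a5 a6) =
      fromBlocks
        (!![-(a1 + a2 : ℂ) - (a4 + a5), a1 + a2, a4 + a5;
          a1 + a2, -(a1 + a2 : ℂ) - (a4 + a5), a4 + a5;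
          a4 + a5, a4 + a5, -2 * (a4 + a5)] : Matrix (Fin 3) (Fin 3) ℂ) 0 0
        (fromBlocks
          (!![-a3 - (a1 + a2 + a3) - (a4 + a5 : ℂ), a1 - a2;
            a1 - a2, -a3 - (a1 + a2 + a3) - (a4 + a5 : ℂ)] : Matrix (Fin 2) (Fin 2) ℂ) 0 0
          (fromBlocks
            (!![-2 * (a1 + a2 + a3 : ℂ), a4 - a5; a4 - a5, -2 * (a1 + a2 + a3 : ℂ)] :
              Matrix (Fin 2) (Fin 2) ℂ) 0 0
            (!![-2 * (a1 + a2 + a3 : ℂ), 2 * a6 - (a4 + a5);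
              2 * a6 - (a4 + a5), -2 * (a1 + a2 + a3 : ℂ)] : Matrix (Fin 2) (Fin 2) ℂ))) := by
  rw [gen3, gm8_kron]
  ext i j
  rcases i with i | i | i | i <;> rcases j with j | j | j | j <;>
  fin_cases i <;> fin_cases j <;>
  simp [grpEquiv, ungrp, gm1, gm2, gm3, gm4, gm5, gm6, gm7] <;> ring

/-- the characteristic polynomial of the 9×9 generator `L₃` is
`∏ᵢ₌₁⁹ (X − αᵢ)` with the nine eigenvalues `αᵢ` listed in the paper. -/
theorem gen3_charpoly (a1 a2 a3 a4 a5 a6 : ℝ) :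
    (gen3 a1 a2 a3 a4 a5 a6).charpoly
      = (X - C ((0 : ℝ) : ℂ))
        * (X - C ((-2 * a1 - 2 * a2 - a4 - a5 : ℝ) : ℂ))
        * (X - C ((-2 * a1 - 2 * a3 - a4 - a5 : ℝ) : ℂ))
        * (X - C ((-2 * a2 - 2 * a3 - a4 - a5 : ℝ) : ℂ))
        * (X - C ((-2 * a1 - 2 * a2 - 2 * a3 + a4 - a5 : ℝ) : ℂ))
        * (X - C ((-2 * a1 - 2 * a2 - 2 * a3 - a4 + a5 : ℝ) : ℂ))
        * (X - C ((-3 * (a4 + a5) : ℝ) : ℂ))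
        * (X - C ((-2 * a1 - 2 * a2 - 2 * a3 + a4 + a5 - 2 * a6 : ℝ) : ℂ))
        * (X - C ((-2 * a1 - 2 * a2 - 2 * a3 - a4 - a5 + 2 * a6 : ℝ) : ℂ)) := by
  rw [← Matrix.charpoly_reindex grpEquiv, gen3_blocks]
  simp only [Matrix.charpoly_fromBlocks_zero₁₂, two_charpoly, three_charpoly]
  have key : ∀ f1 f2 f3 f4 f5 f6 f7 f8 f9 : ℂ[X],
      f1 * f2 * f7 * (f4 * f3 * (f5 * f6 * (f9 * f8)))
        = f1 * f2 * f3 * f4 * f5 * f6 * f7 * f8 * f9 := by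
    intros; ring
  rw [key]
  have hx : (X : ℂ[X]) = X - C ((0 : ℝ) : ℂ) := by simp
  have hc : ∀ {z w : ℂ}, z = w → (X - C z : ℂ[X]) = X - C w := fun h => by rw [h]
  refine congrArg₂ _ (congrArg₂ _ (congrArg₂ _ (congrArg₂ _ (congrArg₂ _ (congrArg₂ _
    (congrArg₂ _ (congrArg₂ _ hx (hc ?_)) (hc ?_)) (hc ?_)) (hc ?_)) (hc ?_)) (hc ?_))
    (hc ?_)) (hc ?_) <;> push_cast <;> ring

end
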